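/- Let g : [0,1] → [0,1] be a monotonically decreasing function whose hypograph Ω_g = {(u,v) ∈ [0,1]² : v ≤ g(u)} is symmetric about the line y = x (i.e. for almost every (u,v) ∈ [0,1]², v ≤ g(u) if and only if u ≤ g(v)), and let f1(x,y) = |Ω_g ∩ ([0,x]×[0,y])|. Then for all x ∈ [0,1] and all y with g(x) ≤ y ≤ 1, f1(x,y) = x·g(x) + ∫_{g(x)}^{y} g(z) dz. -/

import Mathlib

open MeasureTheory Set

noncomputable section

/-- The closed unit square `[0,1]²` in `ℝ × ℝ`. -/
def unitSq : Set (ℝ × ℝ) := Icc (0:ℝ) 1 ×ˢ Icc (0:ℝ) 1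

/-- The anchored axis-parallel box `[0,x] × [0,y]`. -/
def box (x y : ℝ) : Set (ℝ × ℝ) := Icc (0:ℝ) x ×ˢ Icc (0:ℝ) y

/-- The uniform probability measure on a set `S ⊆ ℝ²`. -/
def unif (S : Set (ℝ × ℝ)) : Measure (ℝ × ℝ) := (volume S)⁻¹ • volume.restrict S

/-- The number of the two points `p1`, `p2` lying in the box `[0,x] × [0,y]`. -/
def countIn (p1 p2 : ℝ × ℝ) (x y : ℝ) : ℝ :=
  (box x y).indicator (fun _ => (1:ℝ)) p1 + (box x y).indicator (fun _ => (1:ℝ)) p2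

/-- The squared L2 discrepancy of the two-point multiset `{p1, p2}`. -/
def L2sq (p1 p2 : ℝ × ℝ) : ℝ :=
  ∫ x in (0:ℝ)..1, ∫ y in (0:ℝ)..1, |countIn p1 p2 x y / 2 - x * y| ^ 2

/-- The joint law of the jittered pair `(p1, p2)`: `p1` uniform on `Ω`,
`p2` uniform on `[0,1]² \ Ω`, independent. -/
def jitter (Ω : Set (ℝ × ℝ)) : Measure ((ℝ × ℝ) × (ℝ × ℝ)) :=
  (unif Ω).prod (unif (unitSq \ Ω))

/-- The expected squared L2 discrepancy of the two-point jittered sampling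
construction associated to `Ω`. -/
def Djit (Ω : Set (ℝ × ℝ)) : ℝ := ∫ q, L2sq q.1 q.2 ∂(jitter Ω)

/-- `f1 Ω x y` is the Lebesgue measure of `Ω ∩ ([0,x] × [0,y])`. -/
def f1 (Ω : Set (ℝ × ℝ)) (x y : ℝ) : ℝ := (volume (Ω ∩ box x y)).toReal

/-- The hypograph of `g` within the unit square. -/
def hypo (g : ℝ → ℝ) : Set (ℝ × ℝ) := {q ∈ unitSq | q.2 ≤ g q.1}

/-- `g` is an admissible partitioning function for area `p`: it is monotonically
decreasing on `[0,1]`, maps `[0,1]` into `[0,1]`, its hypograph has Lebesgue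
measure `p`, and its hypograph is symmetric about the diagonal `y = x` up to a
Lebesgue-null set. -/
def Admissible (p : ℝ) (g : ℝ → ℝ) : Prop :=
  AntitoneOn g (Icc (0:ℝ) 1) ∧ (∀ x ∈ Icc (0:ℝ) 1, g x ∈ Icc (0:ℝ) 1) ∧
  volume (hypo g) = ENNReal.ofReal p ∧
  (∀ᵐ q ∂(volume.restrict unitSq), (q ∈ hypo g ↔ q.swap ∈ hypo g))

end
theorem measurableSet_unitSq : MeasurableSet unitSq :=
  measurableSet_Icc.prod measurableSet_Icc

/-- If the hypograph of a decreasing `g` is almost everywhere symmetric about the diagonal, then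
`g x < v` forces `g v ≤ x`: otherwise the rectangle `(x, g v) × (g x, v)` breaks the symmetry. -/
theorem le_of_lt_of_ae_symm {g : ℝ → ℝ} (hmono : AntitoneOn g (Icc (0:ℝ) 1))
    (hrange : ∀ x ∈ Icc (0:ℝ) 1, g x ∈ Icc (0:ℝ) 1)
    (hsym : ∀ᵐ q ∂(volume.restrict unitSq), (q.2 ≤ g q.1 ↔ q.1 ≤ g q.2))
    {x v : ℝ} (hx : x ∈ Icc (0:ℝ) 1) (hv : v ∈ Icc (0:ℝ) 1) (hxv : g x < v) : g v ≤ x := by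
  by_contra! h
  have hgx := hrange x hx
  have hgv := hrange v hv
  have hsub : Ioo x (g v) ×ˢ Ioo (g x) v ⊆ unitSq := by
    rintro ⟨a, b⟩ ⟨⟨ha1, ha2⟩, hb1, hb2⟩
    exact ⟨⟨hx.1.trans ha1.le, ha2.le.trans hgv.2⟩, hgx.1.trans hb1.le, hb2.le.trans hv.2⟩
  have hnull : volume (Ioo x (g v) ×ˢ Ioo (g x) v) = 0 := by
    rw [ae_restrict_iff' measurableSet_unitSq] at hsym
    refine measure_mono_null ?_ hsym
    rintro ⟨a, b⟩ hab hiff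
    have hmem : a ∈ Icc (0:ℝ) 1 ∧ b ∈ Icc (0:ℝ) 1 := hsub hab
    obtain ⟨⟨ha1, ha2⟩, hb1, hb2⟩ := hab
    have h1 : a ≤ g b := ha2.le.trans (hmono hmem.2 hv hb2.le)
    have h2 : b ≤ g a := (hiff (hsub ⟨⟨ha1, ha2⟩, hb1, hb2⟩)).2 h1
    exact absurd (h2.trans (hmono hx hmem.1 ha1.le)) hb1.not_ge
  rw [Measure.volume_eq_prod, Measure.prod_prod, Real.volume_Ioo, Real.volume_Ioo, mul_eq_zero,
    ENNReal.ofReal_eq_zero, ENNReal.ofReal_eq_zero] at hnull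
  rcases hnull with h0 | h0 <;> linarith

/-- The area of the region `{(u, v) | a < v ≤ b, 0 ≤ u ≤ G v}` for decreasing `G ≥ 0`. -/
theorem volume_horizontal_region {G : ℝ → ℝ} (hG : Antitone G) (hG0 : ∀ z, 0 ≤ G z)
    {a b : ℝ} (hab : a ≤ b) :
    MeasurableSet {q : ℝ × ℝ | q.2 ∈ Ioc a b ∧ q.1 ∈ Icc 0 (G q.2)} ∧
      volume {q : ℝ × ℝ | q.2 ∈ Ioc a b ∧ q.1 ∈ Icc 0 (G q.2)} =
        ENNReal.ofReal (∫ z in a..b, G z) := by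
  have hmeas : MeasurableSet {q : ℝ × ℝ | q.2 ∈ Ioc a b ∧ q.1 ∈ Icc 0 (G q.2)} :=
    (measurable_snd measurableSet_Ioc).inter
      ((measurableSet_le measurable_const measurable_fst).inter
        (measurableSet_le measurable_fst (hG.measurable.comp measurable_snd)))
  refine ⟨hmeas, ?_⟩
  rw [intervalIntegral.integral_of_le hab, ofReal_integral_eq_lintegral_ofReal
    ((intervalIntegrable_iff_integrableOn_Ioc_of_le hab).1 hG.intervalIntegrable)
    (Filter.Eventually.of_forall hG0), Measure.volume_eq_prod, Measure.prod_apply_symm hmeas,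
    ← lintegral_indicator measurableSet_Ioc]
  congr 1 with v
  by_cases hv : v ∈ Ioc a b
  · have : (fun u : ℝ => (u, v)) ⁻¹' {q : ℝ × ℝ | q.2 ∈ Ioc a b ∧ q.1 ∈ Icc 0 (G q.2)} =
        Icc 0 (G v) := by
      ext u
      simp only [mem_preimage, mem_ofPred_eq, hv, true_and]
    rw [this, Real.volume_Icc, indicator_of_mem hv, sub_zero]
  · have : (fun u : ℝ => (u, v)) ⁻¹' {q : ℝ × ℝ | q.2 ∈ Ioc a b ∧ q.1 ∈ Icc 0 (G q.2)} = ∅ := by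
      ext u
      simp only [mem_preimage, mem_ofPred_eq, hv, false_and, mem_empty_iff_false]
    rw [this, measure_empty, indicator_of_notMem hv]

/-- For a monotonically decreasing `g : [0,1] → [0,1]` whose
hypograph is symmetric about the diagonal up to a null set, the measure of
`Ω_g ∩ ([0,x]×[0,y])` for `g x ≤ y ≤ 1` is `x·g(x) + ∫_{g x}^{y} g(z) dz`. -/
theorem f1_formula_vertical
    (g : ℝ → ℝ) (hmono : AntitoneOn g (Icc (0:ℝ) 1))
    (hrange : ∀ x ∈ Icc (0:ℝ) 1, g x ∈ Icc (0:ℝ) 1)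
    (hsym : ∀ᵐ q ∂(volume.restrict unitSq), (q.2 ≤ g q.1 ↔ q.1 ≤ g q.2)) :
    ∀ x ∈ Icc (0:ℝ) 1, ∀ y : ℝ, g x ≤ y → y ≤ 1 →
      f1 (hypo g) x y = x * g x + ∫ z in (g x)..y, g z := by
  intro x hx y hgy hy
  have hgx := hrange x hx
  set G : ℝ → ℝ := IccExtend zero_le_one fun z : Icc (0:ℝ) 1 => g z
  have hGanti : Antitone G := fun a b hab =>
    hmono (projIcc 0 1 zero_le_one a).2 (projIcc 0 1 zero_le_one b).2
      (monotone_projIcc zero_le_one hab)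
  have hG0 : ∀ z, 0 ≤ G z := fun z => (hrange _ (projIcc 0 1 zero_le_one z).2).1
  have hGg : ∀ z ∈ Icc (0:ℝ) 1, G z = g z := fun z hz => IccExtend_of_mem _ _ hz
  have hmem : ∀ z, z ∈ Ioc (g x) y → z ∈ Icc (0:ℝ) 1 := fun z hz =>
    ⟨hgx.1.trans hz.1.le, hz.2.trans hy⟩
  obtain ⟨hmeas, hvol⟩ := volume_horizontal_region hGanti hG0 hgy
  have hae : (hypo g ∩ box x y : Set (ℝ × ℝ)) =ᵐ[volume]
      (box x (g x) ∪ {q : ℝ × ℝ | q.2 ∈ Ioc (g x) y ∧ q.1 ∈ Icc 0 (G q.2)} : Set (ℝ × ℝ)) := by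
    have hsq_ae := (ae_restrict_iff' measurableSet_unitSq).1 hsym
    refine Filter.eventuallyEq_set.2 (hsq_ae.mono ?_)
    rintro ⟨u, v⟩ huv
    constructor
    · rintro ⟨⟨hsq, hle⟩, hu, hv⟩
      rcases le_or_gt v (g x) with h | h
      · exact Or.inl ⟨hu, hv.1, h⟩
      · refine Or.inr ⟨⟨h, hv.2⟩, hu.1, ?_⟩
        exact ((huv hsq).1 hle).trans_eq (hGg v hsq.2).symm
    · rintro (⟨hu, hv⟩ | ⟨hv, hu⟩)
      · have hu1 : u ∈ Icc (0:ℝ) 1 := ⟨hu.1, hu.2.trans hx.2⟩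
        exact ⟨⟨⟨hu1, hv.1, hv.2.trans hgx.2⟩, hv.2.trans (hmono hu1 hx hu.2)⟩, hu,
          hv.1, hv.2.trans hgy⟩
      · have hv1 := hmem v hv
        have hug : u ≤ g v := hu.2.trans_eq (hGg v hv1)
        have hux : u ≤ x := hug.trans (le_of_lt_of_ae_symm hmono hrange hsym hx hv1 hv.1)
        have hsq : (u, v) ∈ unitSq := ⟨⟨hu.1, hux.trans hx.2⟩, hv1⟩
        exact ⟨⟨hsq, (huv hsq).2 hug⟩, ⟨hu.1, hux⟩, hv1.1, hv.2⟩
  have hdisj : Disjoint (box x (g x))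
      {q : ℝ × ℝ | q.2 ∈ Ioc (g x) y ∧ q.1 ∈ Icc 0 (G q.2)} :=
    disjoint_left.2 fun q hq hq' => hq'.1.1.not_ge hq.2.2
  have hint : ∫ z in (g x)..y, G z = ∫ z in (g x)..y, g z := by
    rw [intervalIntegral.integral_of_le hgy, intervalIntegral.integral_of_le hgy]
    exact setIntegral_congr_fun measurableSet_Ioc fun z hz => hGg z (hmem z hz)
  have hint0 : 0 ≤ ∫ z in (g x)..y, g z := by
    rw [← hint]
    exact intervalIntegral.integral_nonneg hgy fun z _ => hG0 z
  have hbox : volume (box x (g x)) = ENNReal.ofReal (x * g x) := by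
    rw [box, Measure.volume_eq_prod, Measure.prod_prod, Real.volume_Icc, Real.volume_Icc, sub_zero,
      sub_zero, ENNReal.ofReal_mul hx.1]
  have hxg := mul_nonneg hx.1 hgx.1
  rw [f1, measure_congr hae, measure_union hdisj hmeas, hvol, hint, hbox,
    ← ENNReal.ofReal_add hxg hint0, ENNReal.toReal_ofReal (add_nonneg hxg hint0)]
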